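/- arXiv:2003.03986 — 6 statements merged into one kernel-verified Lean document; each statement's English description precedes it below -/
import Mathlib

section
/- Let n ≥ 1 and α > 0, let A be the n×n real upper shift matrix, k_BW ∈ ℝⁿ the bandwidth-parameterization gain vector at ω = α, and Φ = α I + Aᵀ (which is invertible). If P ∈ ℝ^{n×n} satisfies α P = −(Aᵀ P + P A) + (1/2) k_BW k_BWᵀ, then its columns p₁, …, pₙ satisfy the recursion Φ p₁ = (k₁/2) k_BW and Φ p_i = −p_{i−1} + (k_i/2) k_BW for i = 2, …, n; consequently the last column is pₙ = Σ_{i=1}^{n} (−1)^{n−i} Φ^{−(n−i+1)} (k_i/2) k_BW. -/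
open Matrix

/-- The `n × n` upper shift matrix: `A i j = 1` if `j = i + 1`, else `0`. -/
noncomputable def shiftMat (n : ℕ) : Matrix (Fin n) (Fin n) ℝ :=
  Matrix.of fun i j => if (j : ℕ) = (i : ℕ) + 1 then 1 else 0

/-- Bandwidth-parameterization controller gains: the 1-based gain
`k_i = C(n, i-1) α^(n-i+1)`; with 0-based index `i : Fin n` this is
`k i = C(n, i) α^(n-i)`. -/
noncomputable def kBW (n : ℕ) (α : ℝ) : Fin n → ℝ :=
  fun i => (n.choose (i : ℕ)) * α ^ (n - (i : ℕ))

/-- Solution of the recursion `p 0 = Q b₀`, `p (m + 1) = Q (b (m + 1) - p m)`. -/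
lemma eq_sum_of_mulVec_recursion {ι R : Type*} [Fintype ι] [DecidableEq ι] [CommRing R]
    (Q : Matrix ι ι R) (p b : ℕ → ι → R) (N : ℕ) (h0 : p 0 = Q *ᵥ b 0)
    (hs : ∀ m, m + 1 < N → p (m + 1) = Q *ᵥ (b (m + 1) - p m)) (m : ℕ) (hm : m < N) :
    p m = ∑ j ∈ Finset.range (m + 1), (-1 : R) ^ (m - j) • (Q ^ (m + 1 - j)) *ᵥ b j := by
  induction m with
  | zero => simpa using h0
  | succ m ih =>
    rw [hs m hm, ih (by lia), Finset.sum_range_succ _ (m + 1), mulVec_sub, sub_eq_neg_add, mulVec_sum,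
      ← Finset.sum_neg_distrib]
    congr 1
    · refine Finset.sum_congr rfl fun j hj => ?_
      have hj' : j ≤ m := by simpa [Nat.lt_succ_iff] using hj
      rw [mulVec_smul, mulVec_mulVec, ← pow_succ', Nat.sub_add_comm hj',
        Nat.sub_add_comm (show j ≤ m + 1 by lia), pow_succ (-1 : R), Nat.sub_add_comm hj']
      simp
    · simp

lemma isUnit_smul_one_add_shiftMat_transpose (n : ℕ) {α : ℝ} (hα : α ≠ 0) :
    IsUnit (α • (1 : Matrix (Fin n) (Fin n) ℝ) + (shiftMat n)ᵀ) := by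
  rw [isUnit_iff_isUnit_det, det_of_isLowerTriangular]
  · simp [shiftMat, hα]
  · intro i j hij
    have hlt : (i : ℕ) < j := hij
    have hne : i ≠ j := fun h => by simp [h] at hlt
    have hshift : (i : ℕ) ≠ j + 1 := by lia
    simp [shiftMat, one_apply_ne hne, hshift]

lemma mul_shiftMat_apply_zero {n : ℕ} (P : Matrix (Fin n) (Fin n) ℝ) (r j : Fin n)
    (hj : (j : ℕ) = 0) : (P * shiftMat n) r j = 0 := by
  simp [mul_apply, shiftMat, hj]

lemma mul_shiftMat_apply_of_pos {n : ℕ} (P : Matrix (Fin n) (Fin n) ℝ) (r j : Fin n)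
    (hj : 0 < (j : ℕ)) :
    (P * shiftMat n) r j = P r ⟨(j : ℕ) - 1, lt_of_le_of_lt (Nat.sub_le _ _) j.isLt⟩ := by
  have h (s : Fin n) : (j : ℕ) = s + 1 ↔
      s = ⟨(j : ℕ) - 1, lt_of_le_of_lt (Nat.sub_le _ _) j.isLt⟩ := by
    rw [Fin.ext_iff]
    dsimp only
    lia
  simp [mul_apply, shiftMat, h]

/-- If `α P = -(Aᵀ P + P A) + (1/2) k_BW k_BWᵀ`, then the columns `p_i` of `P`
satisfy `Φ p₁ = (k₁/2) k_BW` and `Φ p_i = -p_{i-1} + (k_i/2) k_BW` for `i ≥ 2`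
(with `Φ = α I + Aᵀ`, which is invertible), and hence the last column is
`pₙ = Σ_{i=1}^{n} (-1)^(n-i) Φ^(-(n-i+1)) (k_i/2) k_BW`. -/
theorem riccati_column_recursion (n : ℕ) (hn : 1 ≤ n) (α : ℝ) (hα : 0 < α)
    (P : Matrix (Fin n) (Fin n) ℝ)
    (hP : α • P = -((shiftMat n)ᵀ * P + P * shiftMat n)
        + (1 / 2 : ℝ) • vecMulVec (kBW n α) (kBW n α)) :
    IsUnit (α • (1 : Matrix (Fin n) (Fin n) ℝ) + (shiftMat n)ᵀ)
    ∧ (α • (1 : Matrix (Fin n) (Fin n) ℝ) + (shiftMat n)ᵀ) *ᵥ (fun r => P r ⟨0, hn⟩)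
        = (kBW n α ⟨0, hn⟩ / 2) • kBW n α
    ∧ (∀ j : Fin n, 0 < (j : ℕ) →
        (α • (1 : Matrix (Fin n) (Fin n) ℝ) + (shiftMat n)ᵀ) *ᵥ (fun r => P r j)
          = -(fun r => P r ⟨(j : ℕ) - 1, lt_of_le_of_lt (Nat.sub_le _ _) j.isLt⟩)
            + (kBW n α j / 2) • kBW n α)
    ∧ (fun r => P r ⟨n - 1, Nat.sub_lt hn one_pos⟩)
        = ∑ j : Fin n, ((-1 : ℝ) ^ (n - 1 - (j : ℕ)))
            • (((α • (1 : Matrix (Fin n) (Fin n) ℝ) + (shiftMat n)ᵀ)⁻¹) ^ (n - (j : ℕ)))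
              *ᵥ ((kBW n α j / 2) • kBW n α) := by
  set Φ := α • (1 : Matrix (Fin n) (Fin n) ℝ) + (shiftMat n)ᵀ with hΦ
  have hunit : IsUnit Φ := isUnit_smul_one_add_shiftMat_transpose n hα.ne'
  have hcol (j : Fin n) : Φ *ᵥ (fun r => P r j)
      = -(fun r => (P * shiftMat n) r j) + (kBW n α j / 2) • kBW n α := by
    ext r
    have h := congrFun (congrFun hP r) j
    have hmul : ((shiftMat n)ᵀ *ᵥ fun r => P r j) r = ((shiftMat n)ᵀ * P) r j := rfl
    simp only [Matrix.add_apply, Matrix.neg_apply, Matrix.smul_apply, vecMulVec_apply,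
      smul_eq_mul] at h
    simp only [hΦ, add_mulVec, smul_mulVec, one_mulVec, Pi.add_apply, Pi.smul_apply,
      Pi.neg_apply, smul_eq_mul, hmul]
    linear_combination h
  have hfirst : Φ *ᵥ (fun r => P r ⟨0, hn⟩) = (kBW n α ⟨0, hn⟩ / 2) • kBW n α := by
    simp only [hcol, mul_shiftMat_apply_zero P _ ⟨0, hn⟩ rfl]
    ext r
    simp
  have hnext (j : Fin n) (hj : 0 < (j : ℕ)) : Φ *ᵥ (fun r => P r j)
      = -(fun r => P r ⟨(j : ℕ) - 1, lt_of_le_of_lt (Nat.sub_le _ _) j.isLt⟩)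
        + (kBW n α j / 2) • kBW n α := by
    simp only [hcol, mul_shiftMat_apply_of_pos P _ j hj]
  refine ⟨hunit, hfirst, hnext, ?_⟩
  have hinv {v w : Fin n → ℝ} (h : Φ *ᵥ v = w) : v = Φ⁻¹ *ᵥ w := by
    rw [← h, mulVec_mulVec, nonsing_inv_mul _ ((isUnit_iff_isUnit_det _).1 hunit), one_mulVec]
  let p : ℕ → Fin n → ℝ := fun m r => if h : m < n then P r ⟨m, h⟩ else 0
  let b : ℕ → Fin n → ℝ := fun m => ((n.choose m * α ^ (n - m)) / 2) • kBW n α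
  have hp (m : ℕ) (hm : m < n) : p m = fun r => P r ⟨m, hm⟩ := by
    ext r
    simp [p, hm]
  have hsum := eq_sum_of_mulVec_recursion Φ⁻¹ p b n
    (by rw [hp 0 hn]; exact hinv hfirst)
    (fun m hm => by
      rw [hp (m + 1) hm, hp m (by lia), sub_eq_neg_add]
      exact hinv (hnext ⟨m + 1, hm⟩ m.succ_pos))
    (n - 1) (Nat.sub_lt hn one_pos)
  rw [hp _ (Nat.sub_lt hn one_pos), Nat.sub_add_cancel hn] at hsum
  rw [hsum, ← Fin.sum_univ_eq_sum_range
    (fun j => (-1 : ℝ) ^ (n - 1 - j) • (Φ⁻¹ ^ (n - j)) *ᵥ b j)]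
  rfl
end

section
/- Let n ≥ 1 and α > 0, let A be the n×n real upper shift matrix, b = eₙ the last standard basis vector of ℝⁿ, and k_BW ∈ ℝⁿ the bandwidth-parameterization gain vector at ω = α. If P ∈ ℝ^{n×n} satisfies the linear matrix equation α P + Aᵀ P + P A = (1/2) k_BW k_BWᵀ, then the last row of P equals half the bandwidth gains: bᵀ P = (1/2) k_BWᵀ. -/
open Matrix

/-- The last standard basis vector `eₙ` of `ℝⁿ`. -/
noncomputable def lastVec (n : ℕ) : Fin n → ℝ :=
  fun i => if (i : ℕ) = n - 1 then 1 else 0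

theorem shiftMat_pow_apply (n m : ℕ) (i j : Fin n) :
    (shiftMat n ^ m) i j = if (j : ℕ) = i + m then 1 else 0 := by
  induction m generalizing j with
  | zero => simp [Matrix.one_apply, Fin.ext_iff, eq_comm]
  | succ m ih =>
    rw [pow_succ, Matrix.mul_apply]
    simp only [ih, ite_mul, one_mul, zero_mul]
    by_cases h : (i : ℕ) + m < n
    · rw [Finset.sum_eq_single ⟨i + m, h⟩]
      · simp [shiftMat, add_assoc]
      · intro b _ hb
        rw [if_neg fun h' => hb (Fin.ext h')]
      · simp
    · rw [Finset.sum_eq_zero fun b _ => if_neg (by omega), if_neg (by omega)]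

theorem shiftMat_pow_self (n : ℕ) : shiftMat n ^ n = 0 := by
  ext i j
  rw [shiftMat_pow_apply, if_neg (by omega), Matrix.zero_apply]

theorem isUnit_smul_one_add_shiftMat (n : ℕ) {α : ℝ} (hα : α ≠ 0) :
    IsUnit (α • (1 : Matrix (Fin n) (Fin n) ℝ) + shiftMat n) := by
  have hu : IsUnit (α • (1 : Matrix (Fin n) (Fin n) ℝ)) := by
    simpa [Units.smul_def] using (isUnit_one (M := Matrix (Fin n) (Fin n) ℝ)).smul (Units.mk0 α hα)
  have hnil : IsNilpotent (shiftMat n) := ⟨n, shiftMat_pow_self n⟩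
  exact hnil.isUnit_add_left_of_commute hu ((Commute.one_right _).smul_right α)

theorem shiftMat_transpose_mul_apply_zero {n : ℕ} (P : Matrix (Fin n) (Fin n) ℝ)
    (h : 0 < n) : ((shiftMat n)ᵀ * P) ⟨0, h⟩ = 0 := by
  ext j
  simp [Matrix.mul_apply, shiftMat]

theorem shiftMat_transpose_mul_apply_succ {n : ℕ} (P : Matrix (Fin n) (Fin n) ℝ) {i : ℕ}
    (h : i + 1 < n) :
    ((shiftMat n)ᵀ * P) ⟨i + 1, h⟩ = P ⟨i, by omega⟩ := by
  ext j
  rw [Matrix.mul_apply, Finset.sum_eq_single ⟨i, by omega⟩]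
  · simp [shiftMat]
  · intro b _ hb
    have : i ≠ (b : ℕ) := fun h' => hb (Fin.ext h'.symm)
    simp [shiftMat, this]
  · simp

/-- Eliminating the intermediate terms of the recurrence `r (i + 1) D = r i - κ i v`. -/
theorem vecMul_pow_eq_of_recurrence {ι R : Type*} [Fintype ι] [DecidableEq ι] [CommRing R]
    (D : Matrix ι ι R) (r : ℕ → ι → R) (κ : ℕ → R) (v : ι → R) (h0 : r 0 = 0) (n : ℕ)
    (h : ∀ i < n, r (i + 1) ᵥ* D = r i - κ i • v) :
    r n ᵥ* D ^ n = -(v ᵥ* ∑ i ∈ Finset.range n, κ i • D ^ i) := by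
  induction n with
  | zero => simp [h0]
  | succ n ih =>
    rw [pow_succ', ← Matrix.vecMul_vecMul, h n n.lt_succ_self, Matrix.sub_vecMul,
      ih fun i hi => h i (by omega), Finset.sum_range_succ, Matrix.vecMul_add,
      Matrix.vecMul_smul, Matrix.smul_vecMul]
    abel

theorem sum_choose_smul_neg_smul_one_add_shiftMat_pow (n : ℕ) (α : ℝ) :
    ∑ i ∈ Finset.range n, ((n.choose i : ℝ) * α ^ (n - i)) •
        (-(α • (1 : Matrix (Fin n) (Fin n) ℝ) + shiftMat n)) ^ i =
      -(-(α • (1 : Matrix (Fin n) (Fin n) ℝ) + shiftMat n)) ^ n := by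
  set D := -(α • (1 : Matrix (Fin n) (Fin n) ℝ) + shiftMat n) with hD
  have hcomm : Commute D (α • (1 : Matrix (Fin n) (Fin n) ℝ)) :=
    (Commute.one_right _).smul_right α
  have hsum : D + α • (1 : Matrix (Fin n) (Fin n) ℝ) = -shiftMat n := by rw [hD]; abel
  have hpow := hcomm.add_pow n
  rw [hsum, neg_pow, shiftMat_pow_self, mul_zero, Finset.sum_range_succ] at hpow
  rw [eq_neg_iff_add_eq_zero, hpow]
  congr 1
  · refine Finset.sum_congr rfl fun i _ => ?_
    rw [smul_pow, one_pow, mul_smul_comm, mul_one, ← nsmul_eq_mul', ← Nat.cast_smul_eq_nsmul ℝ,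
      smul_smul]
  · simp

theorem lastVec_vecMul {n : ℕ} (P : Matrix (Fin n) (Fin n) ℝ) (h : n - 1 < n) :
    lastVec n ᵥ* P = P ⟨n - 1, h⟩ := by
  have : lastVec n = Pi.single ⟨n - 1, h⟩ 1 := by
    ext i
    simp [lastVec, Pi.single_apply, Fin.ext_iff]
  rw [this, Matrix.single_one_vecMul]
  rfl

/-- If `P` solves the linear matrix equation `α P + Aᵀ P + P A = (1/2) k_BW k_BWᵀ`,
then the last row of `P` equals half the bandwidth gains: `bᵀ P = (1/2) k_BWᵀ`. -/
theorem riccati_last_row_half_gain (n : ℕ) (hn : 1 ≤ n) (α : ℝ) (hα : 0 < α)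
    (P : Matrix (Fin n) (Fin n) ℝ)
    (hP : α • P + (shiftMat n)ᵀ * P + P * shiftMat n
        = (1 / 2 : ℝ) • vecMulVec (kBW n α) (kBW n α)) :
    lastVec n ᵥ* P = (1 / 2 : ℝ) • kBW n α := by
  set D := -(α • (1 : Matrix (Fin n) (Fin n) ℝ) + shiftMat n) with hD
  let r : ℕ → Fin n → ℝ
    | 0 => 0
    | i + 1 => if h : i < n then P ⟨i, h⟩ else 0
  have hrec : ∀ i < n, r (i + 1) ᵥ* D =
      r i - ((n.choose i : ℝ) * α ^ (n - i)) • ((1 / 2 : ℝ) • kBW n α) := by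
    intro i hi
    have hshift : ((shiftMat n)ᵀ * P) ⟨i, hi⟩ = r i := by
      cases i with
      | zero => exact shiftMat_transpose_mul_apply_zero P hi
      | succ i =>
        rw [shiftMat_transpose_mul_apply_succ P hi]
        simp [r, show i < n by omega]
    have hrow : α • P ⟨i, hi⟩ + r i + P ⟨i, hi⟩ ᵥ* shiftMat n =
        ((n.choose i : ℝ) * α ^ (n - i)) • ((1 / 2 : ℝ) • kBW n α) := by
      rw [← hshift]
      ext j
      have hij := congrFun (congrFun hP ⟨i, hi⟩) j
      simp only [Matrix.add_apply, Matrix.smul_apply, Matrix.vecMulVec_apply, smul_eq_mul] at hij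
      simp only [Pi.add_apply, Pi.smul_apply, smul_eq_mul]
      rw [← Matrix.mul_apply_eq_vecMul, hij]
      simp only [kBW]
      ring
    rw [← hrow]
    simp only [r, hi, dite_true, hD, Matrix.vecMul_neg, Matrix.vecMul_add, Matrix.vecMul_smul,
      Matrix.vecMul_one]
    abel
  have hlast := vecMul_pow_eq_of_recurrence D r _ _ rfl n hrec
  rw [sum_choose_smul_neg_smul_one_add_shiftMat_pow, Matrix.vecMul_neg, neg_neg] at hlast
  have hunit : IsUnit (D ^ n) := ((isUnit_smul_one_add_shiftMat n hα.ne').neg).pow n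
  have hr : r n = (1 / 2 : ℝ) • kBW n α := Matrix.vecMul_injective_of_isUnit hunit hlast
  rw [lastVec_vecMul P (by omega), ← hr]
  obtain ⟨m, rfl⟩ : ∃ m, n = m + 1 := ⟨n - 1, by omega⟩
  simp [r]
end

section
/- Half-gain tuning theorem: let n ≥ 1 and α > 0, let A be the n×n real upper shift matrix, b = eₙ the last standard basis vector of ℝⁿ, and k_BW ∈ ℝⁿ the bandwidth-parameterization gain vector at ω = α. Then there exists a symmetric matrix P ∈ ℝ^{n×n} solving the algebraic Riccati equation (A + (α/2) I)ᵀ P + P (A + (α/2) I) − 2 P b bᵀ P = 0 whose associated α-controller gain vector k_αᵀ = bᵀ P satisfies k_α = (1/2) k_BW, i.e. the α-controller gains are exactly half the bandwidth-parameterization gains. -/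
open Matrix

open Polynomial in
/-- The first `n` coefficients of a polynomial, as a vector. -/
noncomputable def coeffVec (n : ℕ) : ℝ[X] →ₗ[ℝ] (Fin n → ℝ) :=
  LinearMap.pi fun i => Polynomial.lcoeff ℝ (i : ℕ)

theorem coeffVec_apply (n : ℕ) (q : Polynomial ℝ) (i : Fin n) :
    coeffVec n q i = q.coeff i := rfl

/-- Right multiplication by the shift matrix is multiplication by `X` on coefficient vectors. -/
theorem coeffVec_vecMul_shiftMat (n : ℕ) (q : Polynomial ℝ) :
    coeffVec n q ᵥ* shiftMat n = coeffVec n (Polynomial.X * q) := by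
  ext ⟨i, hi⟩
  simp only [vecMul, dotProduct, coeffVec_apply, shiftMat, Matrix.of_apply, mul_ite, mul_one,
    mul_zero]
  cases i with
  | zero => simp
  | succ m =>
    rw [Polynomial.coeff_X_mul, Finset.sum_eq_single ⟨m, by omega⟩]
    · simp
    · rintro ⟨l, hl⟩ - hne
      have : l ≠ m := by simpa using hne
      exact if_neg (by simp only; omega)
    · simp

theorem lastVec_dotProduct_coeffVec (n : ℕ) (hn : 1 ≤ n) (q : Polynomial ℝ) :
    lastVec n ⬝ᵥ coeffVec n q = q.coeff (n - 1) := by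
  simp only [dotProduct, coeffVec_apply, lastVec, ite_mul, one_mul, zero_mul]
  rw [Finset.sum_eq_single ⟨n - 1, by omega⟩]
  · simp
  · rintro ⟨l, hl⟩ - hne
    have : l ≠ n - 1 := by simpa using hne
    exact if_neg this
  · simp

/-- The homogeneous interpolation `(X + α) ^ k * X ^ (m - k)` between `X ^ m` and
`(X + α) ^ m`. -/
noncomputable def mixedPow (α : ℝ) (m k : ℕ) : Polynomial ℝ :=
  (Polynomial.X + Polynomial.C α) ^ k * Polynomial.X ^ (m - k)

theorem X_mul_mixedPow (α : ℝ) {n k : ℕ} (hk : k < n) :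
    Polynomial.X * mixedPow α (n - 1) k = mixedPow α n k := by
  obtain ⟨d, rfl⟩ : ∃ d, n = k + d + 1 := ⟨n - k - 1, by omega⟩
  have h₁ : k + d + 1 - 1 - k = d := by omega
  have h₂ : k + d + 1 - k = d + 1 := by omega
  rw [mixedPow, mixedPow, h₁, h₂]
  ring

theorem smul_mixedPow (α : ℝ) {n k : ℕ} (hk : k < n) :
    α • mixedPow α (n - 1) k = mixedPow α n (k + 1) - mixedPow α n k := by
  rw [← X_mul_mixedPow α hk, Polynomial.smul_eq_C_mul, mixedPow, mixedPow,
    show n - (k + 1) = n - 1 - k by omega]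
  ring

theorem coeff_mixedPow_self (α : ℝ) {m k : ℕ} (hk : k ≤ m) :
    (mixedPow α m k).coeff m = 1 := by
  have hm : (mixedPow α m k).Monic :=
    ((Polynomial.monic_X_add_C α).pow k).mul (Polynomial.monic_X_pow _)
  have hd : (mixedPow α m k).natDegree = m := by
    rw [mixedPow, ((Polynomial.monic_X_add_C α).pow k).natDegree_mul (Polynomial.monic_X_pow _),
      (Polynomial.monic_X_add_C α).natDegree_pow]
    simp
    omega
  simpa [hd] using hm.coeff_natDegree

theorem coeffVec_mixedPow_zero (n : ℕ) (α : ℝ) : coeffVec n (mixedPow α n 0) = 0 := by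
  ext i
  simp [coeffVec_apply, mixedPow, Polynomial.coeff_X_pow, i.isLt.ne]

theorem coeffVec_mixedPow_self (n : ℕ) (α : ℝ) : coeffVec n (mixedPow α n n) = kBW n α := by
  ext i
  simp [coeffVec_apply, mixedPow, kBW, Polynomial.coeff_X_add_C_pow, mul_comm]

/-- The solution of the Riccati equation, as a sum of rank-one matrices. -/
noncomputable def riccatiSol (n : ℕ) (α : ℝ) : Matrix (Fin n) (Fin n) ℝ :=
  (α / 2) • ∑ k ∈ Finset.range n,
    vecMulVec (coeffVec n (mixedPow α (n - 1) k)) (coeffVec n (mixedPow α (n - 1) k))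

theorem riccatiSol_isSymm (n : ℕ) (α : ℝ) : (riccatiSol n α).IsSymm := by
  simp [Matrix.IsSymm, riccatiSol, transpose_sum, transpose_vecMulVec]

theorem lastVec_vecMul_riccatiSol (n : ℕ) (hn : 1 ≤ n) (α : ℝ) :
    lastVec n ᵥ* riccatiSol n α = (1 / 2 : ℝ) • kBW n α := by
  have key : ∀ k ∈ Finset.range n,
      α • (lastVec n ᵥ* vecMulVec (coeffVec n (mixedPow α (n - 1) k))
        (coeffVec n (mixedPow α (n - 1) k))) =
      coeffVec n (mixedPow α n (k + 1)) - coeffVec n (mixedPow α n k) := by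
    intro k hk
    have hk := Finset.mem_range.1 hk
    rw [vecMul_vecMulVec, lastVec_dotProduct_coeffVec n hn, coeff_mixedPow_self α (by omega),
      one_smul, ← map_smul, smul_mixedPow α hk, map_sub]
  rw [riccatiSol, vecMul_smul, vecMul_sum, show α / 2 = (1 / 2 : ℝ) * α by ring, mul_smul,
    Finset.smul_sum, Finset.sum_congr rfl key,
    Finset.sum_range_sub fun k => coeffVec n (mixedPow α n k),
    coeffVec_mixedPow_zero, coeffVec_mixedPow_self, sub_zero]

/-- The Lyapunov operator of `riccatiSol` telescopes to a rank-one matrix. -/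
theorem lyapunov_riccatiSol (n : ℕ) (α : ℝ) :
    (shiftMat n + (α / 2) • 1)ᵀ * riccatiSol n α
        + riccatiSol n α * (shiftMat n + (α / 2) • 1) =
      (1 / 2 : ℝ) • vecMulVec (kBW n α) (kBW n α) := by
  have key : ∀ k ∈ Finset.range n,
      α • ((shiftMat n + (α / 2) • 1)ᵀ * vecMulVec (coeffVec n (mixedPow α (n - 1) k))
          (coeffVec n (mixedPow α (n - 1) k))
        + vecMulVec (coeffVec n (mixedPow α (n - 1) k)) (coeffVec n (mixedPow α (n - 1) k))
          * (shiftMat n + (α / 2) • 1)) =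
      vecMulVec (coeffVec n (mixedPow α n (k + 1))) (coeffVec n (mixedPow α n (k + 1)))
        - vecMulVec (coeffVec n (mixedPow α n k)) (coeffVec n (mixedPow α n k)) := by
    intro k hk
    have hk := Finset.mem_range.1 hk
    have hs : coeffVec n (mixedPow α n (k + 1)) =
        coeffVec n (mixedPow α n k) + α • coeffVec n (mixedPow α (n - 1) k) := by
      rw [← map_smul, smul_mixedPow α hk, map_sub, add_sub_cancel]
    rw [mul_vecMulVec, vecMulVec_mul, mulVec_transpose, vecMul_add, coeffVec_vecMul_shiftMat,
      X_mul_mixedPow α hk, hs, vecMul_smul, vecMul_one]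
    ext i j
    simp only [Matrix.smul_apply, Matrix.add_apply, Matrix.sub_apply, vecMulVec_apply,
      Pi.add_apply, Pi.smul_apply,
      smul_eq_mul]
    ring
  rw [riccatiSol, mul_smul_comm, smul_mul_assoc, ← smul_add, Finset.mul_sum, Finset.sum_mul,
    ← Finset.sum_add_distrib, show α / 2 = (1 / 2 : ℝ) * α by ring, mul_smul,
    Finset.smul_sum, ← show α / 2 = (1 / 2 : ℝ) * α by ring, Finset.sum_congr rfl key,
    Finset.sum_range_sub fun k =>
      vecMulVec (coeffVec n (mixedPow α n k)) (coeffVec n (mixedPow α n k)),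
    coeffVec_mixedPow_zero, coeffVec_mixedPow_self, vecMulVec_zero, sub_zero]

/-- Half-gain tuning theorem: there exists a symmetric `P` solving the algebraic
Riccati equation `(A + (α/2) I)ᵀ P + P (A + (α/2) I) - 2 P b bᵀ P = 0` whose
α-controller gain vector `k_αᵀ = bᵀ P` is exactly half the bandwidth gains,
`k_α = (1/2) k_BW`. -/
theorem half_gain_tuning (n : ℕ) (hn : 1 ≤ n) (α : ℝ) (hα : 0 < α) :
    ∃ P : Matrix (Fin n) (Fin n) ℝ, P.IsSymm
      ∧ (shiftMat n + (α / 2) • 1)ᵀ * P + P * (shiftMat n + (α / 2) • 1)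
          - (2 : ℝ) • (P * vecMulVec (lastVec n) (lastVec n) * P) = 0
      ∧ lastVec n ᵥ* P = (1 / 2 : ℝ) • kBW n α := by
  have hgain := lastVec_vecMul_riccatiSol n hn α
  refine ⟨riccatiSol n α, riccatiSol_isSymm n α, ?_, hgain⟩
  have hgain' : riccatiSol n α *ᵥ lastVec n = (1 / 2 : ℝ) • kBW n α := by
    rw [← hgain, ← mulVec_transpose, (riccatiSol_isSymm n α).eq]
  rw [lyapunov_riccatiSol, mul_vecMulVec, vecMulVec_mul, hgain, hgain']
  ext i j
  simp only [Matrix.smul_apply, Matrix.sub_apply, vecMulVec_apply, Pi.smul_apply, smul_eq_mul,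
    Matrix.zero_apply]
  ring
end

section
/- Let n ≥ 1 and α > 0, let A be the n×n real upper shift matrix, b = eₙ the last standard basis vector of ℝⁿ, and k_BW ∈ ℝⁿ the bandwidth-parameterization gain vector at ω = α. Then the closed-loop characteristic polynomial under half-gain feedback satisfies det(λI − (A − (1/2) b k_BWᵀ)) = (1/2)(λⁿ + (λ + α)ⁿ) as polynomials in λ. -/
open Matrix Polynomial

/-- The determinant of `xI` minus the shift matrix plus a last row `c` is the polynomial
`xⁿ⁺¹ + ∑ cⱼ xʲ`. -/
theorem det_companion {R : Type*} [CommRing R] (x : R) (n : ℕ) (c : Fin (n + 1) → R) :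
    (Matrix.of fun i j : Fin (n + 1) => (if i = j then x else 0)
      - (if (j : ℕ) = (i : ℕ) + 1 then 1 else 0) + (if (i : ℕ) = n then c j else 0)).det
      = x ^ (n + 1) + ∑ j, c j * x ^ (j : ℕ) := by
  induction n with
  | zero => simp
  | succ n ih =>
    rw [det_succ_column_zero, Fin.sum_univ_succ, Fin.sum_univ_castSucc, Finset.sum_eq_zero]
    · have hlast : ((Matrix.of fun i j : Fin (n + 2) => (if i = j then x else 0)
          - (if (j : ℕ) = (i : ℕ) + 1 then 1 else 0)
          + (if (i : ℕ) = n + 1 then c j else 0)).submatrix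
            (Fin.last (n + 1)).succAbove Fin.succ).det = (-1) ^ (n + 1) := by
        rw [det_of_isLowerTriangular]
        · rw [Finset.prod_eq_pow_card (b := -1)]
          · simp
          · intro i _
            have : (i : ℕ) ≠ n + 1 := by omega
            simp [Fin.ext_iff, this]
        · intro i j hij
          have hij : (i : ℕ) < j := hij
          have h₁ : (i : ℕ) ≠ n + 1 := by omega
          have h₂ : (i : ℕ) ≠ j + 1 := by omega
          have h₃ : (j : ℕ) ≠ i := by omega
          simp [Fin.ext_iff, h₁, h₂, h₃]
      have hsub : (Matrix.of fun i j : Fin (n + 2) => (if i = j then x else 0)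
          - (if (j : ℕ) = (i : ℕ) + 1 then 1 else 0)
          + (if (i : ℕ) = n + 1 then c j else 0)).submatrix
            (Fin.succAbove 0) Fin.succ = Matrix.of fun i j : Fin (n + 1) =>
          (if i = j then x else 0) - (if (j : ℕ) = (i : ℕ) + 1 then 1 else 0)
          + (if (i : ℕ) = n then c j.succ else 0) := by
        ext i j
        simp [Fin.ext_iff]
      rw [hsub, ih fun j => c j.succ, Fin.succ_last, hlast, Fin.sum_univ_succ (n := n + 1)]
      have hsign : ((-1 : R) ^ (n + 1)) * (-1) ^ (n + 1) = 1 := by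
        rw [← mul_pow]; simp
      have hshift : ∑ j : Fin (n + 1), c j.succ * x ^ ((j : ℕ) + 1)
          = x * ∑ j : Fin (n + 1), c j.succ * x ^ (j : ℕ) := by
        rw [Finset.mul_sum]
        exact Finset.sum_congr rfl fun j _ => by ring
      simp [Fin.ext_iff, hshift]
      linear_combination c 0 * hsign
    · intro i _
      have : (i : ℕ) ≠ n := by omega
      simp [Fin.ext_iff, this]

/-- The closed-loop characteristic polynomial under half-gain feedback:
`det(λI - (A - (1/2) b k_BWᵀ)) = (1/2)(λⁿ + (λ + α)ⁿ)`. -/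
theorem half_gain_charpoly (n : ℕ) (hn : 1 ≤ n) (α : ℝ) (hα : 0 < α) :
    (shiftMat n - (1 / 2 : ℝ) • vecMulVec (lastVec n) (kBW n α)).charpoly
      = C (1 / 2 : ℝ) * (X ^ n + (X + C α) ^ n) := by
  obtain ⟨m, rfl⟩ : ∃ m, n = m + 1 := ⟨n - 1, by omega⟩
  have hmat : (shiftMat (m + 1)
      - (1 / 2 : ℝ) • vecMulVec (lastVec (m + 1)) (kBW (m + 1) α)).charmatrix
      = Matrix.of fun i j : Fin (m + 1) => (if i = j then X else 0)
        - (if (j : ℕ) = (i : ℕ) + 1 then 1 else 0)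
        + (if (i : ℕ) = m then C (1 / 2 * kBW (m + 1) α j) else 0) := by
    ext1 i j
    rw [charmatrix_apply, diagonal_apply]
    simp only [shiftMat, lastVec, vecMulVec_apply, Matrix.sub_apply, Matrix.smul_apply, of_apply,
      smul_eq_mul, Nat.add_sub_cancel]
    split_ifs <;> simp only [map_sub, map_mul, map_one, map_zero] <;> ring
  have hbinom : (X + C α) ^ (m + 1)
      = X ^ (m + 1) + ∑ j : Fin (m + 1), C (kBW (m + 1) α j) * X ^ (j : ℕ) := by
    rw [add_pow, Finset.sum_range_succ, Finset.sum_range, add_comm]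
    congr 1
    · simp
    · refine Finset.sum_congr rfl fun j _ => ?_
      simp only [kBW, map_mul, map_pow, map_natCast]
      ring
  have hhalf : (C (1 / 2 : ℝ) : ℝ[X]) + C (1 / 2 : ℝ) = 1 := by
    rw [← C_add]; norm_num
  rw [Matrix.charpoly, hmat, det_companion, hbinom]
  simp only [C_mul, mul_assoc, ← Finset.mul_sum]
  linear_combination (-X ^ (m + 1)) * hhalf
end

section
/- Let n ≥ 1 and α > 0, let A be the n×n real upper shift matrix, b = eₙ the last standard basis vector of ℝⁿ, and k_BW ∈ ℝⁿ the bandwidth-parameterization gain vector at ω = α. Then every complex eigenvalue of the half-gain closed-loop matrix A − (1/2) b k_BWᵀ has real part exactly −α/2; in particular, A − (1/2) b k_BWᵀ is Hurwitz (all eigenvalues have negative real part). -/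
open Matrix

/-- Two complex numbers `z` and `z + α`, `α ≠ 0` real, of equal norm lie on the line
`re z = -α / 2`. -/
theorem re_eq_of_norm_add_ofReal_eq {z : ℂ} {α : ℝ} (hα : α ≠ 0) (h : ‖z + α‖ = ‖z‖) :
    z.re = -α / 2 := by
  have h2 : Complex.normSq (z + α) = Complex.normSq z := by
    rw [Complex.normSq_eq_norm_sq, Complex.normSq_eq_norm_sq, h]
  simp only [Complex.normSq_apply, Complex.add_re, Complex.add_im, Complex.ofReal_re,
    Complex.ofReal_im] at h2
  have h3 : α * (2 * z.re + α) = 0 := by linear_combination h2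
  have h4 := (mul_eq_zero.mp h3).resolve_left hα
  linarith

/-- The binomial expansion of `(z + α) ^ n` without its leading term, in terms of the gains. -/
theorem sum_kBW_mul_pow (n : ℕ) (α : ℝ) (z : ℂ) :
    ∑ j : Fin n, (kBW n α j : ℂ) * z ^ (j : ℕ) = (z + α) ^ n - z ^ n := by
  rw [add_pow, Finset.sum_range_succ, Finset.sum_range]
  simp only [kBW, Nat.sub_self, pow_zero, Nat.choose_self, Nat.cast_one, mul_one,
    add_sub_cancel_right]
  refine Finset.sum_congr rfl fun j _ => ?_
  push_cast
  ring

/-- An eigenvalue `z` of the half-gain closed-loop matrix satisfies `(z + α) ^ n = -z ^ n`. -/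
theorem add_pow_eq_neg_pow_of_mem_spectrum {n : ℕ} (hn : 1 ≤ n) (α : ℝ) {z : ℂ}
    (hz : z ∈ spectrum ℂ
      ((shiftMat n - (1 / 2 : ℝ) • vecMulVec (lastVec n) (kBW n α)).map Complex.ofReal)) :
    (z + α) ^ n = -z ^ n := by
  rw [← Matrix.spectrum_toLin', ← Module.End.hasEigenvalue_iff_mem_spectrum] at hz
  obtain ⟨v, hv⟩ := hz.exists_hasEigenvector
  have hv0 := hv.2
  have hrow := fun i => congrFun hv.apply_eq_smul i
  obtain ⟨m, rfl⟩ : ∃ m, n = m + 1 := ⟨n - 1, by omega⟩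
  have hpow : ∀ i : Fin (m + 1), v i = z ^ (i : ℕ) * v 0 := by
    intro i
    induction i using Fin.induction with
    | zero => simp
    | succ i ih =>
      have h := hrow i.castSucc
      have hi : ¬ ((i : ℕ) = m) := i.isLt.ne
      have hs : ∀ j : Fin (m + 1), ((j : ℕ) = (i : ℕ) + 1) ↔ j = i.succ := fun j => by
        simp [Fin.ext_iff]
      simp [Matrix.mulVec, dotProduct, shiftMat, lastVec, vecMulVec_apply, hi, hs,
        apply_ite Complex.ofReal] at h
      rw [h, ih, Fin.val_succ, Fin.val_castSucc]
      ring
  have hlast := hrow (Fin.last m)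
  have hs : ∀ j : Fin (m + 1), ¬ ((j : ℕ) = m + 1) := fun j => j.isLt.ne
  have hsum : ∑ j : Fin (m + 1), (kBW (m + 1) α j : ℂ) * v j
      = ((z + α) ^ (m + 1) - z ^ (m + 1)) * v 0 := by
    rw [← sum_kBW_mul_pow, Finset.sum_mul]
    exact Finset.sum_congr rfl fun j _ => by rw [hpow j, mul_assoc]
  simp [Matrix.mulVec, dotProduct, shiftMat, lastVec, vecMulVec_apply, hs, mul_assoc,
    ← Finset.mul_sum] at hlast
  rw [hsum, hpow (Fin.last m), Fin.val_last] at hlast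
  have hv00 : v 0 ≠ 0 := fun h => hv0 (funext fun i => by simp [hpow i, h])
  refine mul_right_cancel₀ hv00 ?_
  linear_combination -2 * hlast

/-- Every complex eigenvalue of the half-gain closed-loop matrix
`A - (1/2) b k_BWᵀ` (taken of its complexification) has real part exactly `-α/2`;
in particular the matrix is Hurwitz. -/
theorem half_gain_eigenvalues_re (n : ℕ) (hn : 1 ≤ n) (α : ℝ) (hα : 0 < α) :
    (∀ z ∈ spectrum ℂ
        (((shiftMat n - (1 / 2 : ℝ) • vecMulVec (lastVec n) (kBW n α))).map
          (Complex.ofReal)), z.re = -α / 2)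
    ∧ (∀ z ∈ spectrum ℂ
        (((shiftMat n - (1 / 2 : ℝ) • vecMulVec (lastVec n) (kBW n α))).map
          (Complex.ofReal)), z.re < 0) := by
  have hre : ∀ z ∈ spectrum ℂ
      (((shiftMat n - (1 / 2 : ℝ) • vecMulVec (lastVec n) (kBW n α))).map
        (Complex.ofReal)), z.re = -α / 2 := by
    intro z hz
    refine re_eq_of_norm_add_ofReal_eq hα.ne' ?_
    have h := congrArg norm (add_pow_eq_neg_pow_of_mem_spectrum hn α hz)
    rw [norm_neg, norm_pow, norm_pow] at h
    exact (pow_left_inj₀ (norm_nonneg _) (norm_nonneg _) (by omega)).mp h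
  exact ⟨hre, fun z hz => by rw [hre z hz]; linarith⟩
end

section
/- Let α > 0. For n = 3, the half-gain (α-controller) closed-loop matrix A − (1/2) b k_BWᵀ (the companion matrix with characteristic polynomial λ³ + (3/2) α λ² + (3/2) α² λ + α³/2) has complex eigenvalues λ₁ = −(1/2) α and λ_{2/3} = (−1/2 ± (√3/2) i) · α. -/
open Matrix Polynomial

/-- The half-gain closed-loop matrix for `n = 3`, written out entrywise. -/
theorem halfGainMat_three_eq (α : ℝ) :
    shiftMat 3 - (1 / 2 : ℝ) • vecMulVec (lastVec 3) (kBW 3 α)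
      = !![0, 1, 0; 0, 0, 1; -(α ^ 3 / 2), -((3 / 2) * α ^ 2), -((3 / 2) * α)] := by
  ext i j
  fin_cases i <;> fin_cases j <;>
    simp [shiftMat, lastVec, kBW, vecMulVec_apply, Nat.choose] <;> ring

/-- The characteristic polynomial of a `3 × 3` companion matrix. -/
theorem charpoly_companion_three {R : Type*} [CommRing R] (a b c : R) :
    (!![0, 1, 0; 0, 0, 1; -a, -b, -c] : Matrix (Fin 3) (Fin 3) R).charpoly
      = X ^ 3 + C c * X ^ 2 + C b * X + C a := by
  simp [Matrix.charpoly, det_fin_three]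
  ring

/-- The cubic factors over `ℂ` through `-a / 2` and the nontrivial cube roots of `a ^ 3`. -/
theorem cubic_eq_mul (a z : ℂ) :
    z ^ 3 + (3 / 2) * a * z ^ 2 + (3 / 2) * a ^ 2 * z + a ^ 3 / 2
      = (z - (-(1 / 2)) * a) * ((z - (-(1 / 2) + ((Real.sqrt 3 : ℂ) / 2) * Complex.I) * a)
        * (z - (-(1 / 2) - ((Real.sqrt 3 : ℂ) / 2) * Complex.I) * a)) := by
  have h3 : (Real.sqrt 3 : ℂ) ^ 2 = 3 := by
    rw [← Complex.ofReal_pow, Real.sq_sqrt (by norm_num)]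
    norm_num
  linear_combination (z + a / 2) * a ^ 2 / 4 * (Complex.I ^ 2 * h3 + 3 * Complex.I_sq)

/-- For `n = 3`, the half-gain closed-loop matrix `A - (1/2) b k_BWᵀ` (a companion
matrix with characteristic polynomial `λ³ + (3/2) α λ² + (3/2) α² λ + α³/2`) has complex
eigenvalues `λ₁ = -(1/2) α` and `λ_{2/3} = (-1/2 ± (√3/2) i) α`. -/
theorem half_gain_eigenvalues_n3 (α : ℝ) (hα : 0 < α) :
    (shiftMat 3 - (1 / 2 : ℝ) • vecMulVec (lastVec 3) (kBW 3 α)).charpoly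
        = X ^ 3 + C ((3 / 2) * α) * X ^ 2 + C ((3 / 2) * α ^ 2) * X + C (α ^ 3 / 2)
    ∧ spectrum ℂ
        ((shiftMat 3 - (1 / 2 : ℝ) • vecMulVec (lastVec 3) (kBW 3 α)).map Complex.ofReal)
        = {(-(1 / 2)) * (α : ℂ),
           (-(1 / 2) + ((Real.sqrt 3 : ℂ) / 2) * Complex.I) * (α : ℂ),
           (-(1 / 2) - ((Real.sqrt 3 : ℂ) / 2) * Complex.I) * (α : ℂ)} := by
  have hchar := (congrArg Matrix.charpoly (halfGainMat_three_eq α)).trans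
    (charpoly_companion_three _ _ _)
  refine ⟨hchar, ?_⟩
  ext z
  have hmap := Matrix.charpoly_map
    (shiftMat 3 - (1 / 2 : ℝ) • vecMulVec (lastVec 3) (kBW 3 α)) Complex.ofRealHom
  rw [hchar] at hmap
  change _ ∈ spectrum ℂ (Matrix.map _ Complex.ofRealHom) ↔ _
  rw [Matrix.mem_spectrum_iff_isRoot_charpoly, hmap]
  have heval := cubic_eq_mul (α : ℂ) z
  simp only [Set.mem_insert_iff, Set.mem_singleton_iff]
  rw [← sub_eq_zero, ← sub_eq_zero (a := z) (b := (_ + _) * _),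
    ← sub_eq_zero (a := z) (b := (_ - _) * _), ← mul_eq_zero, ← mul_eq_zero, ← heval]
  simp [IsRoot.def]
end
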